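/- arXiv:2410.01643 — 8 statements merged into one kernel-verified Lean document; each statement's English description precedes it below -/
import Mathlib

section
/- Let Φ : Matrix X (Fin m) ℝ be a KROPE representation, i.e. Φ * Φᵀ = K₁ + γ • ((P * Φ) * (P * Φ)ᵀ), and assume B := Φᵀ * Φ is invertible. Then every complex eigenvalue μ of the matrix L := γ • B⁻¹ * (Φᵀ * P * Φ) (i.e. every element of the spectrum of the complexification of L) satisfies |μ| ≤ √γ; in particular, since 0 ≤ γ < 1, the spectral radius of L is strictly less than 1. -/
open Matrix

/-- The kernel `min s t` on nonnegative reals is positive semidefinite. -/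
lemma posSemidef_of_min {X : Type*} [Finite X] (s : X → ℝ) (hs : ∀ x, 0 ≤ s x) :
    (Matrix.of fun x y => min (s x) (s y)).PosSemidef := by
  have h := MeasureTheory.posSemidef_matrix_measure_inter (μ := MeasureTheory.volume)
    (s := fun x => Set.Ioc 0 (s x)) (fun _ => measurableSet_Ioc) (fun _ => by simp)
  convert h using 4 with x y
  rw [Set.Ioc_inter_Ioc, max_self, Real.volume_real_Ioc_of_le (le_min (hs x) (hs y)), sub_zero]

/-- The kernel `1 - |a - b| / 2` on `[-1, 1]` is positive semidefinite. -/
lemma posSemidef_of_one_sub_abs_sub_div_two {X : Type*} [Finite X] (r : X → ℝ)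
    (hr : ∀ x, |r x| ≤ 1) :
    (Matrix.of fun x y => 1 - |r x - r y| / 2).PosSemidef := by
  have h := (posSemidef_of_min (fun x => (1 + r x) / 2)
    fun x => by linarith [(abs_le.1 (hr x)).1]).add
    (posSemidef_of_min (fun x => (1 - r x) / 2) fun x => by linarith [(abs_le.1 (hr x)).2])
  convert h using 1
  ext x y
  simp only [of_apply, Matrix.add_apply]
  rcases le_total (r x) (r y) with hxy | hxy
  · rw [abs_of_nonpos (by linarith), min_eq_left (by linarith), min_eq_right (by linarith)]
    ring
  · rw [abs_of_nonneg (by linarith), min_eq_right (by linarith), min_eq_left (by linarith)]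
    ring

/-- If `Φ * Φᵀ` dominates `γ • (Ψ * Ψᵀ)` in the Loewner order, then `Φᵀ` dominates `√γ • Ψᵀ`
vector by vector. -/
lemma smul_dotProduct_vecMul_le {X n : Type*} [Fintype X] [Fintype n]
    {γ : ℝ} {Φ Ψ : Matrix X n ℝ} {K : Matrix X X ℝ} (hK : K.PosSemidef)
    (hΦ : Φ * Φᵀ = K + γ • (Ψ * Ψᵀ)) (w : X → ℝ) :
    γ * ((w ᵥ* Ψ) ⬝ᵥ (w ᵥ* Ψ)) ≤ (w ᵥ* Φ) ⬝ᵥ (w ᵥ* Φ) := by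
  have key : ∀ M : Matrix X n ℝ, w ⬝ᵥ ((M * Mᵀ) *ᵥ w) = (w ᵥ* M) ⬝ᵥ (w ᵥ* M) := fun M => by
    rw [← mulVec_mulVec, dotProduct_mulVec, mulVec_transpose]
  have h := hK.dotProduct_mulVec_nonneg w
  have e := congrArg (fun M => w ⬝ᵥ (M *ᵥ w)) hΦ
  simp only [add_mulVec, smul_mulVec, dotProduct_add, dotProduct_smul, key, smul_eq_mul] at e
  rw [star_trivial] at h
  linarith

/-- A real matrix whose action on real row vectors has squared Euclidean norm at most `c` has all
its complex eigenvalues in the closed disc of radius `√c`. -/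
lemma norm_le_sqrt_of_mem_spectrum_map_ofReal {n : Type*} [Fintype n] [DecidableEq n]
    {A : Matrix n n ℝ} {c : ℝ} (hA : ∀ a : n → ℝ, (a ᵥ* A) ⬝ᵥ (a ᵥ* A) ≤ c * (a ⬝ᵥ a))
    {μ : ℂ} (hμ : μ ∈ spectrum ℂ (A.map Complex.ofReal)) : ‖μ‖ ≤ √c := by
  rw [spectrum.mem_iff, isUnit_iff_isUnit_det, isUnit_iff_ne_zero, not_not,
    ← exists_vecMul_eq_zero_iff] at hμ
  obtain ⟨v, hv0, hv⟩ := hμ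
  rw [vecMul_sub, sub_eq_zero, Algebra.algebraMap_eq_smul_one, vecMul_smul, vecMul_one] at hv
  have hre : ∀ i, ((fun j => (v j).re) ᵥ* A) i = (μ * v i).re := fun i => by
    simpa [vecMul, dotProduct] using (congrArg Complex.re (congrFun hv i)).symm
  have him : ∀ i, ((fun j => (v j).im) ᵥ* A) i = (μ * v i).im := fun i => by
    simpa [vecMul, dotProduct] using (congrArg Complex.im (congrFun hv i)).symm
  have hle : ‖μ‖ ^ 2 * ∑ i, ‖v i‖ ^ 2 ≤ c * ∑ i, ‖v i‖ ^ 2 := by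
    have h := add_le_add (hA fun j => (v j).re) (hA fun j => (v j).im)
    simp only [dotProduct, hre, him, ← mul_add, ← Finset.sum_add_distrib,
      ← Complex.normSq_apply, Complex.normSq_eq_norm_sq, norm_mul, mul_pow] at h
    rwa [← Finset.mul_sum] at h
  have hpos : 0 < ∑ i, ‖v i‖ ^ 2 := by
    obtain ⟨i, hi⟩ := Function.ne_iff.1 hv0
    exact Finset.sum_pos' (fun _ _ => by positivity)
      ⟨i, Finset.mem_univ i, pow_pos (norm_pos_iff.2 hi) 2⟩
  exact Real.le_sqrt_of_sq_le (le_of_mul_le_mul_right hle hpos)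

/-- **KROPE representations have spectral radius at most √γ < 1.**
If `Φ` is a KROPE representation, i.e. `Φ * Φᵀ = K₁ + γ • ((P * Φ) * (P * Φ)ᵀ)`,
and `B := Φᵀ * Φ` is invertible, then every complex eigenvalue `μ` of
`L := γ • B⁻¹ * (Φᵀ * P * Φ)` satisfies `‖μ‖ ≤ √γ`, hence `‖μ‖ < 1`. -/
theorem krope_spectral_radius_lt_one
    {X : Type*} [Fintype X] [Nonempty X] [DecidableEq X]
    (γ : ℝ) (hγ0 : 0 ≤ γ) (hγ1 : γ < 1)
    (P : Matrix X X ℝ) (hPnn : ∀ x y, 0 ≤ P x y) (hProw : ∀ x, ∑ y, P x y = 1)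
    (r : X → ℝ) (hr : ∀ x, |r x| ≤ 1)
    (K₁ : Matrix X X ℝ) (hK₁ : ∀ x y, K₁ x y = 1 - |r x - r y| / 2)
    (m : ℕ) (Φ : Matrix X (Fin m) ℝ)
    (hΦ : Φ * Φᵀ = K₁ + γ • ((P * Φ) * (P * Φ)ᵀ))
    (hB : IsUnit (Φᵀ * Φ)) :
    ∀ μ ∈ spectrum ℂ ((γ • (Φᵀ * Φ)⁻¹ * (Φᵀ * P * Φ)).map (Complex.ofReal)),
      ‖μ‖ ≤ Real.sqrt γ ∧ ‖μ‖ < 1 := by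
  intro μ hμ
  have hK : K₁.PosSemidef := by
    convert posSemidef_of_one_sub_abs_sub_div_two r hr
    ext x y
    exact hK₁ x y
  have hle : ‖μ‖ ≤ √γ := by
    refine norm_le_sqrt_of_mem_spectrum_map_ofReal (fun a => ?_) hμ
    have h := smul_dotProduct_vecMul_le hK hΦ (a ᵥ* ((Φᵀ * Φ)⁻¹ * Φᵀ))
    rw [vecMul_vecMul, vecMul_vecMul, Matrix.mul_assoc _ Φᵀ Φ,
      nonsing_inv_mul _ ((isUnit_iff_isUnit_det _).1 hB), vecMul_one] at h
    have e : γ • (Φᵀ * Φ)⁻¹ * (Φᵀ * P * Φ) = γ • ((Φᵀ * Φ)⁻¹ * Φᵀ * (P * Φ)) := by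
      simp only [Matrix.mul_assoc, smul_mul]
    rw [e, vecMul_smul, smul_dotProduct, dotProduct_smul, smul_eq_mul, smul_eq_mul]
    exact mul_le_mul_of_nonneg_left h hγ0
  exact ⟨hle, hle.trans_lt ((Real.sqrt_lt_sqrt hγ0 hγ1).trans_eq Real.sqrt_one)⟩
end

section
/- Assume −1 < r x < 1 for all x, and assume the abstract rewards are injective, i.e. for all x, y : X, r x = r y implies d(x,y) = 0. Then the KROPE abstraction is Bellman complete: for every f : X → ℝ that is constant on KROPE classes (i.e. d(x,y) = 0 implies f x = f y for all x, y), the Bellman backup T f defined by (T f) x := r x + γ · Σ_{x'} P x x' · f x' is also constant on KROPE classes, i.e. d(x,y) = 0 implies (T f) x = (T f) y for all x, y. -/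
open Matrix

section MinKernel

open MeasureTheory

variable {X : Type*} [Fintype X]

/-- The weighted tail count `t ↦ ∑ z, w z * 1_{(0, a z]}(t)`. -/
noncomputable def weightedTail (w a : X → ℝ) (t : ℝ) : ℝ :=
  ∑ z, w z * (Set.Ioc 0 (a z)).indicator 1 t

lemma weightedTail_sq (w a : X → ℝ) (t : ℝ) :
    weightedTail w a t ^ 2 =
      ∑ x, ∑ y, w x * w y * (Set.Ioc 0 (min (a x) (a y))).indicator 1 t := by
  rw [weightedTail, sq, Finset.sum_mul_sum]
  refine Finset.sum_congr rfl fun x _ => Finset.sum_congr rfl fun y _ => ?_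
  have h : Set.Ioc 0 (min (a x) (a y)) = Set.Ioc 0 (a x) ∩ Set.Ioc 0 (a y) := by
    ext s
    simp only [Set.mem_Ioc, Set.mem_inter_iff, le_min_iff]
    tauto
  rw [h, Set.inter_indicator_one, Pi.mul_apply]
  ring

lemma integrable_indicator_Ioc_one (b c : ℝ) :
    Integrable ((Set.Ioc b c).indicator (1 : ℝ → ℝ)) := by
  rw [integrable_indicator_iff measurableSet_Ioc]
  exact integrableOn_const (by simp)

lemma integrable_weightedTail_sq (w a : X → ℝ) :
    Integrable fun t => weightedTail w a t ^ 2 := by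
  simp only [weightedTail_sq]
  exact integrable_finsetSum _ fun x _ => integrable_finsetSum _ fun y _ =>
    (integrable_indicator_Ioc_one _ _).const_mul _

lemma integral_weightedTail_sq (w a : X → ℝ) (ha : ∀ x, 0 < a x) :
    ∫ t, weightedTail w a t ^ 2 = ∑ x, ∑ y, w x * w y * min (a x) (a y) := by
  simp only [weightedTail_sq]
  rw [integral_finsetSum _ fun x _ => integrable_finsetSum _ fun y _ =>
    (integrable_indicator_Ioc_one _ _).const_mul _]
  refine Finset.sum_congr rfl fun x _ => ?_
  rw [integral_finsetSum _ fun y _ => (integrable_indicator_Ioc_one _ _).const_mul _]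
  refine Finset.sum_congr rfl fun y _ => ?_
  rw [integral_const_mul, integral_indicator_one measurableSet_Ioc, Real.volume_real_Ioc_of_le
    (le_min (ha x).le (ha y).le), sub_zero]

lemma sum_mul_min_nonneg (w a : X → ℝ) (ha : ∀ x, 0 < a x) :
    0 ≤ ∑ x, ∑ y, w x * w y * min (a x) (a y) := by
  rw [← integral_weightedTail_sq w a ha]
  exact integral_nonneg fun t => sq_nonneg _

/-- The kernel `min` is strictly positive definite on positive reals: if the quadratic form
vanishes at `w`, then `w` has zero mass on every fibre of `a`. -/
lemma sum_fiber_eq_zero_of_sum_mul_min_eq_zero (w a : X → ℝ) (ha : ∀ x, 0 < a x)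
    (h : ∑ x, ∑ y, w x * w y * min (a x) (a y) = 0) (x₀ : X) :
    ∑ z with a z = a x₀, w z = 0 := by
  rw [← integral_weightedTail_sq w a ha,
    integral_eq_zero_iff_of_nonneg (fun t => sq_nonneg _) (integrable_weightedTail_sq w a)] at h
  have hdense : Dense {t | weightedTail w a t = 0} := by
    refine Measure.dense_of_ae (μ := volume) ?_
    filter_upwards [h] with t ht
    simpa using ht
  set c := a x₀ with hc
  have hfin : IsClosed (insert 0 (Set.range a) \ {c}) :=
    (((Set.finite_range a).insert 0).sdiff).isClosed
  have hmem : (insert 0 (Set.range a) \ {c})ᶜ ∈ nhds c := hfin.isOpen_compl.mem_nhds (by simp)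
  obtain ⟨δ, hδ, hball⟩ := Metric.mem_nhds_iff.1 hmem
  have hsep : ∀ z, a z ≠ c → a z ≤ c - δ ∨ c + δ ≤ a z := by
    intro z hz
    by_contra! hlt
    refine hball (a := a z) ?_ ⟨Or.inr ⟨z, rfl⟩, hz⟩
    rw [Metric.mem_ball, Real.dist_eq, abs_lt]
    constructor <;> linarith
  have hpos : δ ≤ c := by
    by_contra! hlt
    have hc0 : 0 < c := ha x₀
    refine hball (a := 0) ?_ ⟨Or.inl rfl, hc0.ne⟩
    rw [Metric.mem_ball, Real.dist_eq, abs_lt]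
    constructor <;> linarith
  obtain ⟨s, hs0, hs⟩ := hdense.exists_mem_open (isOpen_Ioo (a := c - δ) (b := c))
    (Set.nonempty_Ioo.2 (by linarith))
  obtain ⟨t, ht0, ht⟩ := hdense.exists_mem_open (isOpen_Ioo (a := c) (b := c + δ))
    (Set.nonempty_Ioo.2 (by linarith))
  rw [Set.mem_ofPred_eq] at hs0 ht0
  rw [Set.mem_Ioo] at hs ht
  have hdiff : weightedTail w a s - weightedTail w a t = 0 := by rw [hs0, ht0, sub_zero]
  rw [← hdiff, weightedTail, weightedTail, ← Finset.sum_sub_distrib, Finset.sum_filter]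
  refine Finset.sum_congr rfl fun z _ => ?_
  have hs_pos : 0 < s := by linarith
  have ht_pos : 0 < t := by linarith
  simp only [Set.indicator_apply, Set.mem_Ioc, hs_pos, ht_pos, true_and, Pi.one_apply]
  by_cases hz : a z = c
  · rw [if_pos hz, if_pos (by linarith), if_neg (by linarith)]
    ring
  · rw [if_neg hz]
    rcases hsep z hz with hlow | hhigh
    · rw [if_neg (by linarith), if_neg (by linarith)]
      ring
    · rw [if_pos (by linarith), if_pos (by linarith)]
      ring

lemma sum_mul_eq_zero_of_sum_fiber_eq_zero (w a f : X → ℝ)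
    (hw : ∀ x₀, ∑ z with a z = a x₀, w z = 0) (hf : ∀ x y, a x = a y → f x = f y) :
    ∑ z, w z * f z = 0 := by
  classical
  rw [← Finset.sum_fiberwise_of_maps_to (t := Finset.univ.image a) (g := a)
    fun z hz => Finset.mem_image_of_mem a hz]
  refine Finset.sum_eq_zero fun c hc => ?_
  obtain ⟨x₀, -, rfl⟩ := Finset.mem_image.1 hc
  rw [Finset.sum_congr rfl fun z hz => by rw [hf z x₀ (Finset.mem_filter.1 hz).2],
    ← Finset.sum_mul, hw x₀, zero_mul]

end MinKernel

section QuadraticForm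

variable {X : Type*} [Fintype X]

lemma dotProduct_mulVec_eq_sum (K : Matrix X X ℝ) (w : X → ℝ) :
    w ⬝ᵥ K *ᵥ w = ∑ x, ∑ y, w x * w y * K x y := by
  simp only [dotProduct, mulVec, Finset.mul_sum]
  exact Finset.sum_congr rfl fun x _ => Finset.sum_congr rfl fun y _ => by ring

/-- On weights of total mass zero, the kernel `1 - |r x - r y| / 2` agrees with
`min (r x + 1) (r y + 1)`. -/
lemma dotProduct_mulVec_eq_sum_mul_min (r : X → ℝ) (K₁ : Matrix X X ℝ)
    (hK₁ : ∀ x y, K₁ x y = 1 - |r x - r y| / 2) (w : X → ℝ) (hw : ∑ x, w x = 0) :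
    w ⬝ᵥ K₁ *ᵥ w = ∑ x, ∑ y, w x * w y * min (r x + 1) (r y + 1) := by
  rw [dotProduct_mulVec_eq_sum]
  have hsplit : ∀ x y, w x * w y * K₁ x y =
      w x * w y * min (r x + 1) (r y + 1) - (w x * (r x / 2) * w y + w x * (w y * (r y / 2))) := by
    intro x y
    rw [hK₁, min_def]
    split_ifs with hxy
    · rw [abs_of_nonpos (by linarith)]
      ring
    · rw [abs_of_nonneg (by linarith)]
      ring
  simp only [hsplit, Finset.sum_sub_distrib, Finset.sum_add_distrib, ← Finset.mul_sum,
    ← Finset.sum_mul, hw, mul_zero, zero_mul, add_zero, Finset.sum_const_zero, sub_zero]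

lemma dotProduct_fixedPoint_mulVec {γ : ℝ} {P K₁ K : Matrix X X ℝ}
    (hK : K = K₁ + γ • (P * K * Pᵀ)) (w : X → ℝ) :
    w ⬝ᵥ K *ᵥ w = w ⬝ᵥ K₁ *ᵥ w + γ * ((Pᵀ *ᵥ w) ⬝ᵥ K *ᵥ (Pᵀ *ᵥ w)) := by
  conv_lhs => rw [hK]
  rw [add_mulVec, dotProduct_add, smul_mulVec, dotProduct_smul, smul_eq_mul,
    ← mulVec_mulVec, ← mulVec_mulVec, dotProduct_mulVec w P, ← mulVec_transpose]

lemma sum_transpose_mulVec {P : Matrix X X ℝ} (hProw : ∀ x, ∑ y, P x y = 1) (w : X → ℝ) :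
    ∑ y, (Pᵀ *ᵥ w) y = ∑ x, w x := by
  simp only [mulVec, dotProduct, transpose_apply]
  rw [Finset.sum_comm]
  simp only [← Finset.sum_mul, hProw, one_mul]

lemma sum_abs_transpose_mulVec_le {P : Matrix X X ℝ} (hPnn : ∀ x y, 0 ≤ P x y)
    (hProw : ∀ x, ∑ y, P x y = 1) (w : X → ℝ) :
    ∑ y, |(Pᵀ *ᵥ w) y| ≤ ∑ x, |w x| := by
  calc ∑ y, |(Pᵀ *ᵥ w) y| ≤ ∑ y, (Pᵀ *ᵥ fun x => |w x|) y := by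
        refine Finset.sum_le_sum fun y _ => (Finset.abs_sum_le_sum_abs _ _).trans_eq ?_
        exact Finset.sum_congr rfl fun x _ => by
          simp only [abs_mul, transpose_apply, abs_of_nonneg (hPnn x y)]
    _ = ∑ x, |w x| := sum_transpose_mulVec hProw _

lemma exists_abs_dotProduct_mulVec_le (K : Matrix X X ℝ) :
    ∃ C, 0 ≤ C ∧ ∀ w : X → ℝ, |w ⬝ᵥ K *ᵥ w| ≤ C * (∑ x, |w x|) ^ 2 := by
  refine ⟨∑ x, ∑ y, |K x y|, by positivity, fun w => ?_⟩
  have hentry : ∀ x y, |K x y| ≤ ∑ x, ∑ y, |K x y| := fun x y =>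
    (Finset.single_le_sum (f := fun y => |K x y|) (fun _ _ => abs_nonneg _)
      (Finset.mem_univ y)).trans
    (Finset.single_le_sum (f := fun x => ∑ y, |K x y|)
      (fun _ _ => Finset.sum_nonneg fun _ _ => abs_nonneg _) (Finset.mem_univ x))
  rw [dotProduct_mulVec_eq_sum, sq, Finset.sum_mul_sum, Finset.mul_sum]
  refine (Finset.abs_sum_le_sum_abs _ _).trans (Finset.sum_le_sum fun x _ => ?_)
  rw [Finset.mul_sum]
  refine (Finset.abs_sum_le_sum_abs _ _).trans (Finset.sum_le_sum fun y _ => ?_)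
  rw [abs_mul, abs_mul, mul_comm]
  exact mul_le_mul_of_nonneg_right (hentry x y) (by positivity)

/-- If `K₁` is positive semidefinite on weights of total mass zero, so is the fixed point of
`K ↦ K₁ + γ • (P * K * Pᵀ)`. -/
lemma dotProduct_fixedPoint_mulVec_nonneg {γ : ℝ} (hγ0 : 0 ≤ γ) (hγ1 : γ < 1)
    {P K₁ K : Matrix X X ℝ} (hPnn : ∀ x y, 0 ≤ P x y) (hProw : ∀ x, ∑ y, P x y = 1)
    (hK : K = K₁ + γ • (P * K * Pᵀ))
    (hK₁ : ∀ w : X → ℝ, ∑ x, w x = 0 → 0 ≤ w ⬝ᵥ K₁ *ᵥ w) (w : X → ℝ) (hw : ∑ x, w x = 0) :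
    0 ≤ w ⬝ᵥ K *ᵥ w := by
  obtain ⟨C, hC, hbound⟩ := exists_abs_dotProduct_mulVec_le K
  have hlower : ∀ n : ℕ, ∀ v : X → ℝ, ∑ x, v x = 0 →
      -(γ ^ n * (C * (∑ x, |v x|) ^ 2)) ≤ v ⬝ᵥ K *ᵥ v := by
    intro n
    induction n with
    | zero =>
      intro v _
      rw [pow_zero, one_mul]
      exact (abs_le.1 (hbound v)).1
    | succ n ih =>
      intro v hv
      have hstep := ih (Pᵀ *ᵥ v) ((sum_transpose_mulVec hProw v).trans hv)
      have hmono : γ ^ n * (C * (∑ x, |(Pᵀ *ᵥ v) x|) ^ 2) ≤ γ ^ n * (C * (∑ x, |v x|) ^ 2) := by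
        have := sum_abs_transpose_mulVec_le hPnn hProw v
        gcongr
      have hscaled := mul_le_mul_of_nonneg_left ((neg_le_neg hmono).trans hstep) hγ0
      rw [dotProduct_fixedPoint_mulVec hK v, pow_succ]
      linarith [hK₁ v hv]
  have hlim : Filter.Tendsto (fun n : ℕ => -(γ ^ n * (C * (∑ x, |w x|) ^ 2)))
      Filter.atTop (nhds 0) := by
    simpa using ((tendsto_pow_atTop_nhds_zero_of_lt_one hγ0 hγ1).mul_const
      (C * (∑ x, |w x|) ^ 2)).neg
  exact le_of_tendsto' hlim fun n => hlower n w hw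

lemma eq_zero_of_eq_smul_mul_mul_transpose [Nonempty X] {γ : ℝ} (hγ0 : 0 ≤ γ) (hγ1 : γ < 1)
    {P D : Matrix X X ℝ} (hPnn : ∀ x y, 0 ≤ P x y) (hProw : ∀ x, ∑ y, P x y = 1)
    (hD : D = γ • (P * D * Pᵀ)) : D = 0 := by
  obtain ⟨⟨x₀, y₀⟩, hmax⟩ := Finite.exists_max fun p : X × X => |D p.1 p.2|
  have hle : |D x₀ y₀| ≤ γ * |D x₀ y₀| := by
    conv_lhs => rw [hD]
    rw [Matrix.smul_apply, smul_eq_mul, abs_mul, abs_of_nonneg hγ0]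
    refine mul_le_mul_of_nonneg_left ?_ hγ0
    calc |(P * D * Pᵀ) x₀ y₀| ≤ ∑ b, ∑ a, P x₀ a * |D x₀ y₀| * P y₀ b := by
          rw [mul_apply]
          refine (Finset.abs_sum_le_sum_abs _ _).trans (Finset.sum_le_sum fun b _ => ?_)
          rw [mul_apply, transpose_apply, Finset.sum_mul]
          refine (Finset.abs_sum_le_sum_abs _ _).trans (Finset.sum_le_sum fun a _ => ?_)
          rw [abs_mul, abs_mul, abs_of_nonneg (hPnn _ _), abs_of_nonneg (hPnn _ _)]
          exact mul_le_mul_of_nonneg_right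
            (mul_le_mul_of_nonneg_left (hmax (a, b)) (hPnn _ _)) (hPnn _ _)
      _ = |D x₀ y₀| := by
          simp only [← Finset.sum_mul, ← Finset.mul_sum, hProw, one_mul, mul_one]
  have hzero : |D x₀ y₀| ≤ 0 := by nlinarith [abs_nonneg (D x₀ y₀)]
  ext x y
  exact abs_nonpos_iff.1 ((hmax (x, y)).trans hzero)

lemma transpose_eq_of_fixedPoint [Nonempty X] {γ : ℝ} (hγ0 : 0 ≤ γ) (hγ1 : γ < 1)
    {P K₁ K : Matrix X X ℝ} (hPnn : ∀ x y, 0 ≤ P x y) (hProw : ∀ x, ∑ y, P x y = 1)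
    (hK₁ : K₁ᵀ = K₁) (hK : K = K₁ + γ • (P * K * Pᵀ)) : Kᵀ = K := by
  have hKt : Kᵀ = K₁ + γ • (P * Kᵀ * Pᵀ) := by
    conv_lhs => rw [hK]
    rw [transpose_add, hK₁, transpose_smul, transpose_mul, transpose_mul, transpose_transpose,
      Matrix.mul_assoc]
  refine sub_eq_zero.1 (eq_zero_of_eq_smul_mul_mul_transpose hγ0 hγ1 hPnn hProw ?_)
  rw [Matrix.mul_sub, Matrix.sub_mul, smul_sub]
  nth_rewrite 1 [hKt]
  nth_rewrite 2 [hK]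
  abel

lemma dotProduct_mulVec_single_sub_single [DecidableEq X] (K : Matrix X X ℝ) (x y : X) :
    (Pi.single x 1 - Pi.single y 1) ⬝ᵥ K *ᵥ (Pi.single x 1 - Pi.single y 1) =
      K x x + K y y - K x y - K y x := by
  simp only [mulVec_sub, sub_dotProduct, dotProduct_sub, mulVec_single_one,
    single_one_dotProduct, col_apply]
  ring

end QuadraticForm

/-- **KROPE representations are Bellman complete.**
Assume `-1 < r x < 1` for all `x` and that abstract rewards are injective
(`r x = r y → d x y = 0`). Then any function constant on KROPE classes has
a Bellman backup that is also constant on KROPE classes. -/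
theorem krope_bellman_complete
    {X : Type*} [Fintype X] [Nonempty X] [DecidableEq X]
    (γ : ℝ) (hγ0 : 0 ≤ γ) (hγ1 : γ < 1)
    (P : Matrix X X ℝ) (hPnn : ∀ x y, 0 ≤ P x y) (hProw : ∀ x, ∑ y, P x y = 1)
    (r : X → ℝ) (hr : ∀ x, |r x| ≤ 1)
    (hr' : ∀ x, -1 < r x ∧ r x < 1)
    (K₁ : Matrix X X ℝ) (hK₁ : ∀ x y, K₁ x y = 1 - |r x - r y| / 2)
    (Kstar : Matrix X X ℝ)
    (hKstar : Kstar = K₁ + γ • (P * Kstar * Pᵀ))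
    (d : X → X → ℝ)
    (hd : ∀ x y, d x y = Kstar x x + Kstar y y - 2 * Kstar x y)
    (hinj : ∀ x y, r x = r y → d x y = 0)
    (T : (X → ℝ) → (X → ℝ))
    (hT : ∀ f x, T f x = r x + γ * ∑ x', P x x' * f x') :
    ∀ f : X → ℝ, (∀ x y, d x y = 0 → f x = f y) →
      ∀ x y, d x y = 0 → T f x = T f y := by
  intro f hf x y hxy
  have hpos : ∀ z, 0 < r z + 1 := fun z => by linarith [(hr' z).1]
  have hK₁nn : ∀ w : X → ℝ, ∑ z, w z = 0 → 0 ≤ w ⬝ᵥ K₁ *ᵥ w := fun w hw => by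
    rw [dotProduct_mulVec_eq_sum_mul_min r K₁ hK₁ w hw]
    exact sum_mul_min_nonneg w _ hpos
  have hKnn := dotProduct_fixedPoint_mulVec_nonneg hγ0 hγ1 hPnn hProw hKstar hK₁nn
  have hK₁symm : K₁ᵀ = K₁ := by
    ext a b
    rw [transpose_apply, hK₁, hK₁, abs_sub_comm]
  have hsymm : Kstar y x = Kstar x y :=
    congrFun (congrFun (transpose_eq_of_fixedPoint hγ0 hγ1 hPnn hProw hK₁symm hKstar) x) y
  set u : X → ℝ := Pi.single x 1 - Pi.single y 1 with hu
  have hsum : ∑ z, (Pᵀ *ᵥ u) z = 0 := by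
    rw [sum_transpose_mulVec hProw]
    simp [hu]
  have hKu : u ⬝ᵥ Kstar *ᵥ u = 0 := by
    rw [hu, dotProduct_mulVec_single_sub_single, hsymm, ← hxy, hd]
    ring
  have hK₁u : u ⬝ᵥ K₁ *ᵥ u = |r x - r y| := by
    rw [hu, dotProduct_mulVec_single_sub_single, hK₁, hK₁, hK₁, hK₁, abs_sub_comm (r y) (r x)]
    simp only [sub_self, abs_zero]
    ring
  rw [dotProduct_fixedPoint_mulVec hKstar, hK₁u] at hKu
  have hnext := mul_nonneg hγ0 (hKnn _ hsum)
  have hrxy : r x = r y :=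
    sub_eq_zero.1 (abs_nonpos_iff.1 (by linarith))
  rw [hT, hT, hrxy]
  congr 1
  rcases hγ0.eq_or_lt with hγ | hγ
  · rw [← hγ, zero_mul, zero_mul]
  have hKw : (Pᵀ *ᵥ u) ⬝ᵥ Kstar *ᵥ (Pᵀ *ᵥ u) = 0 := by
    have hprod : γ * ((Pᵀ *ᵥ u) ⬝ᵥ Kstar *ᵥ (Pᵀ *ᵥ u)) = 0 := by
      linarith [abs_nonneg (r x - r y)]
    exact (mul_eq_zero.1 hprod).resolve_left hγ.ne'
  have hK₁w : (Pᵀ *ᵥ u) ⬝ᵥ K₁ *ᵥ (Pᵀ *ᵥ u) = 0 := by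
    rw [dotProduct_fixedPoint_mulVec hKstar] at hKw
    have hrest := mul_nonneg hγ0 (hKnn _ ((sum_transpose_mulVec hProw (Pᵀ *ᵥ u)).trans hsum))
    linarith [hK₁nn _ hsum]
  rw [dotProduct_mulVec_eq_sum_mul_min r K₁ hK₁ _ hsum] at hK₁w
  have hzero := sum_mul_eq_zero_of_sum_fiber_eq_zero (Pᵀ *ᵥ u) (fun z => r z + 1) f
    (sum_fiber_eq_zero_of_sum_mul_min_eq_zero _ _ hpos hK₁w)
    fun a b hab => hf a b (hinj a b (add_right_cancel hab))
  have hw : ∀ z, (Pᵀ *ᵥ u) z = P x z - P y z := fun z => by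
    simp [hu, mulVec_sub]
  simp only [hw, sub_mul, Finset.sum_sub_distrib] at hzero
  rw [sub_eq_zero.1 hzero]
end

section
/- Let Y be a finite type and φ : X → Y a state-action abstraction that is a π-bisimulation: (i) for all x, y : X, φ x = φ y implies r x = r y, and (ii) for all x, y : X with φ x = φ y and every c : Y, Σ_{x' with φ x' = c} P x x' = Σ_{x' with φ x' = c} P y x'. Then the class of piecewise-constant functions induced by φ is Bellman complete: for every f : X → ℝ with (φ x = φ y → f x = f y) for all x, y, the Bellman backup T f defined by (T f) x := r x + γ · Σ_{x'} P x x' · f x' also satisfies (φ x = φ y → (T f) x = (T f) y) for all x, y. -/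
open Matrix

/-- **π-bisimulation abstractions are Bellman complete.**
If `φ : X → Y` is a π-bisimulation (equal rewards and equal aggregated
transition probabilities within abstract classes), then the Bellman backup of a
piecewise-constant function (w.r.t. `φ`) is again piecewise constant. -/
theorem pi_bisimulation_bellman_complete
    {X : Type*} [Fintype X] [Nonempty X] [DecidableEq X]
    {Y : Type*} [Fintype Y] [DecidableEq Y]
    (γ : ℝ) (hγ0 : 0 ≤ γ) (hγ1 : γ < 1)
    (P : Matrix X X ℝ) (hPnn : ∀ x y, 0 ≤ P x y) (hProw : ∀ x, ∑ y, P x y = 1)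
    (r : X → ℝ) (hr : ∀ x, |r x| ≤ 1)
    (φ : X → Y)
    (hrew : ∀ x y, φ x = φ y → r x = r y)
    (htrans : ∀ x y, φ x = φ y → ∀ c : Y,
      (∑ x' ∈ Finset.univ.filter (fun x' => φ x' = c), P x x') =
      (∑ x' ∈ Finset.univ.filter (fun x' => φ x' = c), P y x'))
    (T : (X → ℝ) → (X → ℝ))
    (hT : ∀ f x, T f x = r x + γ * ∑ x', P x x' * f x') :
    ∀ f : X → ℝ, (∀ x y, φ x = φ y → f x = f y) →
      ∀ x y, φ x = φ y → T f x = T f y := by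
  intro f hf x y hxy
  obtain ⟨g, rfl⟩ := (Function.factorsThrough_iff f).mp fun a b => hf a b
  have sum_eq_sum_fiber (z : X) : ∑ x', P z x' * (g ∘ φ) x' =
      ∑ c, (∑ x' ∈ Finset.univ.filter (fun x' => φ x' = c), P z x') * g c := by
    rw [← Finset.sum_fiberwise Finset.univ φ]
    refine Finset.sum_congr rfl fun c _ => ?_
    rw [Finset.sum_mul]
    refine Finset.sum_congr rfl fun x' hx' => ?_
    rw [Function.comp_apply, (Finset.mem_filter.mp hx').2]
  simp only [hT, sum_eq_sum_fiber, hrew x y hxy, htrans x y hxy]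
end

section
/- The KROPE operator F is a contraction with modulus γ in the entrywise supremum norm: for all K, K' : Matrix X X ℝ and all x, y : X, |F(K) x y − F(K') x y| ≤ γ · (max over pairs (a,b) of |K a b − K' a b|). -/
open Matrix

/-- A convex combination of reals bounded by `M` in absolute value is bounded by `M`. -/
lemma abs_sum_mul_le_of_sum_eq_one {ι : Type*} [Fintype ι] {w f : ι → ℝ} {M : ℝ}
    (hw : ∀ i, 0 ≤ w i) (hsum : ∑ i, w i = 1) (hf : ∀ i, |f i| ≤ M) :
    |∑ i, w i * f i| ≤ M :=
  calc |∑ i, w i * f i| ≤ ∑ i, |w i * f i| := Finset.abs_sum_le_sum_abs _ _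
    _ ≤ ∑ i, w i * M := Finset.sum_le_sum fun i _ => by
        rw [abs_mul, abs_of_nonneg (hw i)]
        exact mul_le_mul_of_nonneg_left (hf i) (hw i)
    _ = M := by rw [← Finset.sum_mul, hsum, one_mul]

/-- Conjugation by a row-stochastic matrix does not increase the entrywise sup norm. -/
lemma abs_mul_mul_transpose_apply_le {X : Type*} [Fintype X] {P D : Matrix X X ℝ} {M : ℝ}
    (hPnn : ∀ x y, 0 ≤ P x y) (hProw : ∀ x, ∑ y, P x y = 1) (hD : ∀ a b, |D a b| ≤ M)
    (x y : X) : |(P * D * Pᵀ) x y| ≤ M := by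
  have h : (P * D * Pᵀ) x y = ∑ b, P y b * ∑ a, P x a * D a b := by
    simp only [Matrix.mul_apply, Matrix.transpose_apply, mul_comm (P y _)]
  rw [h]
  exact abs_sum_mul_le_of_sum_eq_one (hPnn y) (hProw y) fun b =>
    abs_sum_mul_le_of_sum_eq_one (hPnn x) (hProw x) fun a => hD a b

/-- **The KROPE operator is a γ-contraction in the entrywise sup norm.**
For all kernels `K, K'` and all `x, y`,
`|F K x y − F K' x y| ≤ γ · max_{(a,b)} |K a b − K' a b|`. -/
theorem krope_operator_contraction
    {X : Type*} [Fintype X] [Nonempty X] [DecidableEq X]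
    (γ : ℝ) (hγ0 : 0 ≤ γ) (hγ1 : γ < 1)
    (P : Matrix X X ℝ) (hPnn : ∀ x y, 0 ≤ P x y) (hProw : ∀ x, ∑ y, P x y = 1)
    (r : X → ℝ) (hr : ∀ x, |r x| ≤ 1)
    (K₁ : Matrix X X ℝ) (hK₁ : ∀ x y, K₁ x y = 1 - |r x - r y| / 2)
    (F : Matrix X X ℝ → Matrix X X ℝ)
    (hF : ∀ K, F K = K₁ + γ • (P * K * Pᵀ)) :
    ∀ K K' : Matrix X X ℝ, ∀ x y : X,
      |F K x y - F K' x y| ≤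
        γ * (Finset.univ.sup' Finset.univ_nonempty
          (fun p : X × X => |K p.1 p.2 - K' p.1 p.2|)) := by
  intro K K' x y
  have h : F K x y - F K' x y = γ * (P * (K - K') * Pᵀ) x y := by
    simp only [hF, Matrix.mul_sub, Matrix.sub_mul, Matrix.add_apply, Matrix.sub_apply,
      Matrix.smul_apply, smul_eq_mul]
    ring
  rw [h, abs_mul, abs_of_nonneg hγ0]
  refine mul_le_mul_of_nonneg_left
    (abs_mul_mul_transpose_apply_le hPnn hProw (fun a b => ?_) x y) hγ0
  exact Finset.le_sup' (fun p : X × X => |K p.1 p.2 - K' p.1 p.2|) (Finset.mem_univ (a, b))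
end

section
/- For every initial matrix K₀ : Matrix X X ℝ, the sequence of iterates n ↦ F^[n] K₀ converges (entrywise) to the unique fixed point K⋆ of the KROPE operator F. -/
open Matrix Filter

/-- Left multiplication by a row-stochastic matrix preserves entrywise bounds. -/
theorem abs_stochastic_mul_apply_le {X Y : Type*} [Fintype X]
    {P : Matrix X X ℝ} (hPnn : ∀ x y, 0 ≤ P x y) (hProw : ∀ x, ∑ y, P x y = 1)
    {M : Matrix X Y ℝ} {C : ℝ} (hM : ∀ x y, |M x y| ≤ C) (x : X) (y : Y) :
    |(P * M) x y| ≤ C := by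
  rw [Matrix.mul_apply]
  calc |∑ z, P x z * M z y| ≤ ∑ z, |P x z * M z y| := Finset.abs_sum_le_sum_abs _ _
    _ ≤ ∑ z, P x z * C := by
        refine Finset.sum_le_sum fun z _ => ?_
        rw [abs_mul, abs_of_nonneg (hPnn x z)]
        exact mul_le_mul_of_nonneg_left (hM z y) (hPnn x z)
    _ = C := by rw [← Finset.sum_mul, hProw, one_mul]

/-- Conjugation `M ↦ P * M * Pᵀ` by a row-stochastic matrix preserves entrywise bounds. -/
theorem abs_stochastic_mul_mul_transpose_apply_le {X : Type*} [Fintype X]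
    {P : Matrix X X ℝ} (hPnn : ∀ x y, 0 ≤ P x y) (hProw : ∀ x, ∑ y, P x y = 1)
    {M : Matrix X X ℝ} {C : ℝ} (hM : ∀ x y, |M x y| ≤ C) (x y : X) :
    |(P * M * Pᵀ) x y| ≤ C := by
  have h := abs_stochastic_mul_apply_le hPnn hProw (M := (P * M)ᵀ)
    (fun a b => abs_stochastic_mul_apply_le hPnn hProw hM b a) y x
  rwa [← Matrix.transpose_apply (P * (P * M)ᵀ), Matrix.transpose_mul,
    Matrix.transpose_transpose] at h

/-- **Iterates of the KROPE operator converge to its unique fixed point.**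
For every initial kernel `K₀`, the sequence `n ↦ F^[n] K₀` converges
(entrywise, i.e. in the product topology on matrices) to the fixed point
`K⋆` of the KROPE operator `F`. -/
theorem krope_iterates_tendsto_fixed_point
    {X : Type*} [Fintype X] [Nonempty X] [DecidableEq X]
    (γ : ℝ) (hγ0 : 0 ≤ γ) (hγ1 : γ < 1)
    (P : Matrix X X ℝ) (hPnn : ∀ x y, 0 ≤ P x y) (hProw : ∀ x, ∑ y, P x y = 1)
    (r : X → ℝ) (hr : ∀ x, |r x| ≤ 1)
    (K₁ : Matrix X X ℝ) (hK₁ : ∀ x y, K₁ x y = 1 - |r x - r y| / 2)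
    (F : Matrix X X ℝ → Matrix X X ℝ)
    (hF : ∀ K, F K = K₁ + γ • (P * K * Pᵀ))
    (Kstar : Matrix X X ℝ) (hKstar : Kstar = K₁ + γ • (P * Kstar * Pᵀ)) :
    ∀ K₀ : Matrix X X ℝ, Tendsto (fun n => F^[n] K₀) atTop (nhds Kstar) := by
  intro K₀
  obtain ⟨C, hC⟩ : ∃ C, ∀ x y, |(K₀ - Kstar) x y| ≤ C := by
    refine ⟨∑ x, ∑ y, |(K₀ - Kstar) x y|, fun x y => ?_⟩
    calc |(K₀ - Kstar) x y| ≤ ∑ y, |(K₀ - Kstar) x y| :=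
          Finset.single_le_sum (f := fun y => |(K₀ - Kstar) x y|)
            (fun _ _ => abs_nonneg _) (Finset.mem_univ y)
      _ ≤ _ := Finset.single_le_sum (f := fun x => ∑ y, |(K₀ - Kstar) x y|)
            (fun _ _ => Finset.sum_nonneg fun _ _ => abs_nonneg _) (Finset.mem_univ x)
  have hdiff : ∀ K, F K - Kstar = γ • (P * (K - Kstar) * Pᵀ) := by
    intro K
    calc F K - Kstar = (K₁ + γ • (P * K * Pᵀ)) - (K₁ + γ • (P * Kstar * Pᵀ)) := by
          rw [← hKstar, hF]
      _ = _ := by rw [add_sub_add_left_eq_sub, ← smul_sub, ← Matrix.sub_mul, ← Matrix.mul_sub]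
  have hbound : ∀ n x y, |(F^[n] K₀ - Kstar) x y| ≤ γ ^ n * C := by
    intro n
    induction n with
    | zero => simpa using hC
    | succ n ih =>
      intro x y
      rw [Function.iterate_succ_apply', hdiff, Matrix.smul_apply, smul_eq_mul, abs_mul,
        abs_of_nonneg hγ0, pow_succ', mul_assoc γ]
      exact mul_le_mul_of_nonneg_left
        (abs_stochastic_mul_mul_transpose_apply_le hPnn hProw ih x y) hγ0
  have hlim : Tendsto (fun n => γ ^ n * C) atTop (nhds 0) := by
    simpa using (tendsto_pow_atTop_nhds_zero_of_lt_one hγ0 hγ1).mul_const C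
  refine tendsto_pi_nhds.2 fun x => tendsto_pi_nhds.2 fun y => ?_
  rw [tendsto_iff_norm_sub_tendsto_zero]
  exact squeeze_zero (fun _ => norm_nonneg _) (fun n => hbound n x y) hlim
end

section
/- The KROPE operator preserves positive semidefiniteness: if K : Matrix X X ℝ is positive semidefinite, then F(K) = K₁ + γ • (P * K * Pᵀ) is positive semidefinite. -/
open Matrix

open MeasureTheory in
/-- The kernel `1 - |a - b| / 2` on `[-1, 1]` is positive semidefinite: it is the average of the
intersection kernels of the intervals `(-1, a]` and `(a, 1]`. -/
theorem posSemidef_one_sub_abs_sub_div_two {X : Type*} [Finite X] (r : X → ℝ)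
    (hr : ∀ x, |r x| ≤ 1) :
    (Matrix.of fun x y ↦ 1 - |r x - r y| / 2).PosSemidef := by
  have hlower := posSemidef_matrix_measure_inter (μ := (volume : Measure ℝ))
    (s := fun x ↦ Set.Ioc (-1) (r x)) (fun _ ↦ measurableSet_Ioc) (fun _ ↦ by simp)
  have hupper := posSemidef_matrix_measure_inter (μ := (volume : Measure ℝ))
    (s := fun x ↦ Set.Ioc (r x) 1) (fun _ ↦ measurableSet_Ioc) (fun _ ↦ by simp)
  convert (hlower.add hupper).smul (show (0 : ℝ) ≤ 1 / 2 by norm_num) using 1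
  ext x y
  have hx := abs_le.mp (hr x)
  have hy := abs_le.mp (hr y)
  simp only [of_apply, Matrix.smul_apply, Matrix.add_apply, Set.Ioc_inter_Ioc, sup_idem, inf_idem,
    smul_eq_mul]
  rw [Real.volume_real_Ioc_of_le (le_inf hx.1 hy.1), Real.volume_real_Ioc_of_le (sup_le hx.2 hy.2),
    ← max_sub_min_eq_abs']
  ring

/-- **The KROPE operator preserves positive semidefiniteness.**
If `K` is positive semidefinite, then `F K = K₁ + γ • (P * K * Pᵀ)` is
positive semidefinite. -/
theorem krope_operator_preserves_posSemidef
    {X : Type*} [Fintype X] [Nonempty X] [DecidableEq X]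
    (γ : ℝ) (hγ0 : 0 ≤ γ) (hγ1 : γ < 1)
    (P : Matrix X X ℝ) (hPnn : ∀ x y, 0 ≤ P x y) (hProw : ∀ x, ∑ y, P x y = 1)
    (r : X → ℝ) (hr : ∀ x, |r x| ≤ 1)
    (K₁ : Matrix X X ℝ) (hK₁ : ∀ x y, K₁ x y = 1 - |r x - r y| / 2)
    (F : Matrix X X ℝ → Matrix X X ℝ)
    (hF : ∀ K, F K = K₁ + γ • (P * K * Pᵀ)) :
    ∀ K : Matrix X X ℝ, K.PosSemidef → (F K).PosSemidef := by
  intro K hK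
  rw [hF]
  have hK₁_eq : K₁ = Matrix.of fun x y ↦ 1 - |r x - r y| / 2 := Matrix.ext hK₁
  have hPK : (P * K * Pᵀ).PosSemidef := by
    simpa only [conjTranspose_eq_transpose_of_trivial] using hK.mul_mul_conjTranspose_same P
  exact (hK₁_eq ▸ posSemidef_one_sub_abs_sub_div_two r hr).add (hPK.smul hγ0)
end

section
/- The KROPE distance decomposes into the reward difference plus γ times the squared maximum mean discrepancy of the next-state-action distributions: for all x, y : X, d(x,y) = |r x − r y| + γ · Σ_{a,b} (P x a − P y a) · (P x b − P y b) · K⋆ a b. -/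
open Matrix

/-- The entries of `P * K * Pᵀ` as double sums. -/
theorem Matrix.mul_mul_transpose_apply_eq_sum {X R : Type*} [Fintype X] [CommSemiring R]
    (P K : Matrix X X R) (x y : X) :
    (P * K * Pᵀ) x y = ∑ a, ∑ b, P x a * P y b * K a b := by
  simp only [Matrix.mul_apply, Matrix.transpose_apply, Finset.sum_mul]
  rw [Finset.sum_comm]
  exact Finset.sum_congr rfl fun a _ => Finset.sum_congr rfl fun b _ => by ring

/-- For row-stochastic `P` and `0 ≤ γ < 1`, the map `D ↦ γ • (P * D * Pᵀ)` has no nonzero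
fixed point. -/
theorem Matrix.eq_zero_of_eq_smul_stochastic_conj {X : Type*} [Fintype X] {γ : ℝ}
    (hγ0 : 0 ≤ γ) (hγ1 : γ < 1) {P : Matrix X X ℝ} (hPnn : ∀ x y, 0 ≤ P x y)
    (hProw : ∀ x, ∑ y, P x y = 1) {D : Matrix X X ℝ} (hD : D = γ • (P * D * Pᵀ)) :
    D = 0 := by
  ext x y
  have : Nonempty X := ⟨x⟩
  obtain ⟨⟨u, v⟩, hmax⟩ := Finite.exists_max fun p : X × X => |D p.1 p.2|
  have hentry : D u v = γ * ∑ a, ∑ b, P u a * P v b * D a b := by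
    rw [← Matrix.mul_mul_transpose_apply_eq_sum]
    exact congrFun (congrFun hD u) v
  have hbound : |∑ a, ∑ b, P u a * P v b * D a b| ≤ |D u v| :=
    calc |∑ a, ∑ b, P u a * P v b * D a b|
        ≤ ∑ a, ∑ b, |P u a * P v b * D a b| :=
          (Finset.abs_sum_le_sum_abs _ _).trans
            (Finset.sum_le_sum fun _ _ => Finset.abs_sum_le_sum_abs _ _)
      _ ≤ ∑ a, ∑ b, P u a * P v b * |D u v| := by
          refine Finset.sum_le_sum fun a _ => Finset.sum_le_sum fun b _ => ?_
          have hP := mul_nonneg (hPnn u a) (hPnn v b)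
          rw [abs_mul, abs_of_nonneg hP]
          exact mul_le_mul_of_nonneg_left (hmax (a, b)) hP
      _ = |D u v| := by
          simp_rw [← Finset.sum_mul, ← Finset.mul_sum, hProw, mul_one, hProw, one_mul]
  have hcontract : |D u v| ≤ γ * |D u v| := by
    calc |D u v| = γ * |∑ a, ∑ b, P u a * P v b * D a b| := by
          conv_lhs => rw [hentry, abs_mul, abs_of_nonneg hγ0]
      _ ≤ γ * |D u v| := mul_le_mul_of_nonneg_left hbound hγ0
  have hxy : |D x y| ≤ |D u v| := hmax (x, y)
  have huv : |D u v| ≤ 0 := by nlinarith [abs_nonneg (D u v)]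
  exact abs_nonpos_iff.mp (hxy.trans huv)

/-- A fixed point of `K ↦ K₁ + γ • (P * K * Pᵀ)` is symmetric when `K₁` is. -/
theorem Matrix.isSymm_of_eq_add_smul_stochastic_conj {X : Type*} [Fintype X] {γ : ℝ}
    (hγ0 : 0 ≤ γ) (hγ1 : γ < 1) {P : Matrix X X ℝ} (hPnn : ∀ x y, 0 ≤ P x y)
    (hProw : ∀ x, ∑ y, P x y = 1) {K₁ K : Matrix X X ℝ} (hK₁ : K₁.IsSymm)
    (hK : K = K₁ + γ • (P * K * Pᵀ)) : K.IsSymm := by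
  have hKT : Kᵀ = K₁ + γ • (P * Kᵀ * Pᵀ) := by
    conv_lhs => rw [hK]
    simp [Matrix.transpose_mul, hK₁.eq, Matrix.mul_assoc]
  refine sub_eq_zero.mp
    (Matrix.eq_zero_of_eq_smul_stochastic_conj hγ0 hγ1 hPnn hProw ?_)
  refine (congrArg₂ (· - ·) hKT hK).trans ?_
  rw [Matrix.mul_sub, Matrix.sub_mul, smul_sub, add_sub_add_left_eq_sub]

/-- **Decomposition of the KROPE distance.**
For all `x, y`,
`d(x,y) = |r x − r y| + γ · Σ_{a,b} (P x a − P y a) (P x b − P y b) K⋆ a b`,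
i.e. the KROPE distance is the reward difference plus γ times the squared MMD
between the next state-action distributions. -/
theorem krope_distance_decomposition
    {X : Type*} [Fintype X] [Nonempty X] [DecidableEq X]
    (γ : ℝ) (hγ0 : 0 ≤ γ) (hγ1 : γ < 1)
    (P : Matrix X X ℝ) (hPnn : ∀ x y, 0 ≤ P x y) (hProw : ∀ x, ∑ y, P x y = 1)
    (r : X → ℝ) (hr : ∀ x, |r x| ≤ 1)
    (K₁ : Matrix X X ℝ) (hK₁ : ∀ x y, K₁ x y = 1 - |r x - r y| / 2)
    (Kstar : Matrix X X ℝ) (hKstar : Kstar = K₁ + γ • (P * Kstar * Pᵀ))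
    (d : X → X → ℝ)
    (hd : ∀ x y, d x y = Kstar x x + Kstar y y - 2 * Kstar x y) :
    ∀ x y : X, d x y =
      |r x - r y| +
        γ * ∑ a, ∑ b, (P x a - P y a) * (P x b - P y b) * Kstar a b := by
  intro x y
  have hsymm : Kstar.IsSymm := by
    refine Matrix.isSymm_of_eq_add_smul_stochastic_conj hγ0 hγ1 hPnn hProw ?_ hKstar
    ext a b
    rw [Matrix.transpose_apply, hK₁, hK₁, abs_sub_comm]
  have hentry : ∀ u v, Kstar u v =
      1 - |r u - r v| / 2 + γ * ∑ a, ∑ b, P u a * P v b * Kstar a b := by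
    intro u v
    rw [← hK₁, ← Matrix.mul_mul_transpose_apply_eq_sum]
    exact congrFun (congrFun hKstar u) v
  have hexpand : ∑ a, ∑ b, (P x a - P y a) * (P x b - P y b) * Kstar a b =
      ∑ a, ∑ b, P x a * P x b * Kstar a b + ∑ a, ∑ b, P y a * P y b * Kstar a b
        - ∑ a, ∑ b, P x a * P y b * Kstar a b - ∑ a, ∑ b, P y a * P x b * Kstar a b := by
    simp only [← Finset.sum_add_distrib, ← Finset.sum_sub_distrib]
    exact Finset.sum_congr rfl fun a _ => Finset.sum_congr rfl fun b _ => by ring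
  have hxx := hentry x x
  have hyy := hentry y y
  have hxy := hentry x y
  have hyx := hentry y x
  rw [hsymm.apply x y, abs_sub_comm] at hyx
  rw [sub_self, abs_zero] at hxx hyy
  rw [hd, hexpand]
  linarith
end

section
/- Let n : ℕ and x : Fin n → ℝ be such that x is injective and 0 < x i for every i. Then the matrix M : Matrix (Fin n) (Fin n) ℝ defined by M i j = min (x i) (x j) is positive definite. -/
open Matrix

/-- The kernel `min (x i) (x j) - t` is strictly positive on a finite set where `x` is injective
with values exceeding `t`. -/
theorem Finset.sum_mul_min_sub_pos {ι K : Type*} [CommRing K] [LinearOrder K]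
    [IsStrictOrderedRing K] {x : ι → K} (hinj : Function.Injective x) (c : ι → K)
    (s : Finset ι) (t : K) (ht : ∀ i ∈ s, t < x i) (hc : ∃ i ∈ s, c i ≠ 0) :
    0 < ∑ i ∈ s, ∑ j ∈ s, c i * c j * (min (x i) (x j) - t) := by
  classical
  induction s using Finset.induction_on_min_value x generalizing t with
  | empty => simp at hc
  | insert a s ha hmin ih =>
    have hta : 0 < x a - t := sub_pos.2 (ht a (Finset.mem_insert_self a s))
    have hsplit : ∑ i ∈ insert a s, ∑ j ∈ insert a s, c i * c j * (min (x i) (x j) - t) =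
        (x a - t) * (∑ i ∈ insert a s, c i) ^ 2 +
          ∑ i ∈ s, ∑ j ∈ s, c i * c j * (min (x i) (x j) - x a) := by
      have hrestrict : ∑ i ∈ s, ∑ j ∈ s, c i * c j * (min (x i) (x j) - x a) =
          ∑ i ∈ insert a s, ∑ j ∈ insert a s, c i * c j * (min (x i) (x j) - x a) := by
        have hrow : ∑ j ∈ s, c a * c j * (min (x a) (x j) - x a) = 0 :=
          Finset.sum_eq_zero fun j hj => by simp [hmin j hj]
        have hcol : ∑ i ∈ s, c i * c a * (min (x i) (x a) - x a) = 0 :=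
          Finset.sum_eq_zero fun i hi => by simp [hmin i hi]
        simp [Finset.sum_insert ha, Finset.sum_add_distrib, hrow, hcol]
      rw [hrestrict, sq, Finset.sum_mul_sum, Finset.mul_sum, ← Finset.sum_add_distrib]
      refine Finset.sum_congr rfl fun i _ => ?_
      rw [Finset.mul_sum, ← Finset.sum_add_distrib]
      exact Finset.sum_congr rfl fun j _ => by ring
    rw [hsplit]
    by_cases hs : ∃ i ∈ s, c i ≠ 0
    · refine add_pos_of_nonneg_of_pos (by positivity) (ih (x a) (fun i hi => ?_) hs)
      exact (hmin i hi).lt_of_ne fun h => ha (hinj h ▸ hi)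
    · push Not at hs
      have hca : c a ≠ 0 := by
        obtain ⟨i, hi, hci⟩ := hc
        rcases Finset.mem_insert.1 hi with rfl | hi
        · exact hci
        · exact absurd (hs i hi) hci
      have hzero : ∑ i ∈ s, ∑ j ∈ s, c i * c j * (min (x i) (x j) - x a) = 0 :=
        Finset.sum_eq_zero fun i hi => Finset.sum_eq_zero fun j _ => by simp [hs i hi]
      rw [hzero, Finset.sum_insert ha, Finset.sum_eq_zero hs, add_zero, add_zero]
      positivity

/-- **The min-kernel matrix of distinct positive numbers is positive definite.**
If `x : Fin n → ℝ` is injective with strictly positive values, then the matrix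
`M i j = min (x i) (x j)` is positive definite. -/
theorem min_kernel_posDef
    (n : ℕ) (x : Fin n → ℝ) (hinj : Function.Injective x)
    (hpos : ∀ i, 0 < x i) :
    (Matrix.of (fun i j : Fin n => min (x i) (x j))).PosDef := by
  refine .of_dotProduct_mulVec_pos (Matrix.ext fun i j => by simp [min_comm]) fun c hc => ?_
  have h := Finset.sum_mul_min_sub_pos hinj c Finset.univ 0 (fun i _ => hpos i)
    (by simpa using Function.ne_iff.1 hc)
  simpa [dotProduct, mulVec, Finset.mul_sum, mul_assoc, mul_comm, mul_left_comm] using h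
end
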